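/- Let Γ ↷ X be an action of a countable amenable group on the Cantor set, let G be a subgroup of [[Γ ↷ X]] containing 𝔄(Γ,X), and let F be a finite subset of X. Then the left translation action of G on the coset space G/G_(F) admits a G-invariant mean. -/

import Mathlib

open scoped Pointwise

/-- A mean on a set `Z`: a finitely additive probability measure defined on all subsets. -/
def IsMean {Z : Type*} (m : Set Z → ℝ) : Prop :=
  m Set.univ = 1 ∧ (∀ A : Set Z, 0 ≤ m A) ∧
    ∀ A B : Set Z, Disjoint A B → m (A ∪ B) = m A + m B

/-- Amenability of a group: existence of a left-translation-invariant mean. -/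
def HasLeftInvariantMean (Γ : Type*) [Group Γ] : Prop :=
  ∃ m : Set Γ → ℝ, IsMean m ∧ ∀ (g : Γ) (A : Set Γ), m ((fun h => g * h) '' A) = m A

/-- A permutation `T` of `X` is a piecewise translation for the action of `Γ` if there are a
finite clopen partition `A₁, …, Aₙ` of `X` and `s₁, …, sₙ ∈ Γ` with `T x = sᵢ • x` on `Aᵢ`.
The topological full group `[[Γ ↷ X]]` is the set of such permutations. -/
def IsPiecewiseTranslation (Γ : Type*) {X : Type*} [Group Γ] [TopologicalSpace X]
    [MulAction Γ X] (T : Equiv.Perm X) : Prop :=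
  ∃ (n : ℕ) (A : Fin n → Set X) (s : Fin n → Γ),
    (∀ i, IsClopen (A i)) ∧ Pairwise (Function.onFun Disjoint A) ∧
    (⋃ i, A i) = Set.univ ∧ ∀ i, ∀ x ∈ A i, T x = s i • x

/-- The dynamical alternating group `𝔄(Γ, X)`. -/
def dynAlternating (Γ X : Type*) [Group Γ] [TopologicalSpace X] [MulAction Γ X] :
    Subgroup (Equiv.Perm X) :=
  Subgroup.closure
    {g | ∃ (φ : Equiv.Perm (Fin 3) →* Equiv.Perm X) (A : Fin 3 → Set X),
      (∀ σ, IsPiecewiseTranslation Γ (φ σ)) ∧ (∀ i, IsClopen (A i)) ∧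
      Pairwise (Function.onFun Disjoint A) ∧
      (∀ (σ : Equiv.Perm (Fin 3)), ∀ x ∉ ⋃ i, A i, φ σ x = x) ∧
      (∀ (σ : Equiv.Perm (Fin 3)) (i : Fin 3), φ σ '' A i = A (σ i)) ∧
      ∃ σ : Equiv.Perm (Fin 3), Equiv.Perm.sign σ = 1 ∧ g = φ σ}

/-- The subgroup of `Perm X` of permutations fixing pointwise a neighborhood of every point
of `F`. -/
def nbhdFixing (X : Type*) [TopologicalSpace X] (F : Set X) : Subgroup (Equiv.Perm X) where
  carrier := {g | ∀ x ∈ F, ∃ U : Set X, IsOpen U ∧ x ∈ U ∧ ∀ y ∈ U, g y = y}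
  one_mem' := fun x _ => ⟨Set.univ, isOpen_univ, Set.mem_univ x, fun _ _ => rfl⟩
  mul_mem' := by
    intro a b ha hb x hx
    obtain ⟨U, hUo, hxU, hU⟩ := ha x hx
    obtain ⟨V, hVo, hxV, hV⟩ := hb x hx
    refine ⟨U ∩ V, hUo.inter hVo, ⟨hxU, hxV⟩, fun y hy => ?_⟩
    have : (a * b) y = a (b y) := rfl
    rw [this, hV y hy.2, hU y hy.1]
  inv_mem' := by
    intro a ha x hx
    obtain ⟨U, hUo, hxU, hU⟩ := ha x hx
    refine ⟨U, hUo, hxU, fun y hy => ?_⟩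
    have h1 : a y = y := hU y hy
    have : a⁻¹ (a y) = a⁻¹ y := by rw [h1]
    simpa using this.symm

namespace IsMean

variable {Z : Type*} {m : Set Z → ℝ}

lemma empty (hm : IsMean m) : m ∅ = 0 := by
  have h := hm.2.2 ∅ ∅ (by simp)
  simp only [Set.union_empty] at h
  linarith

lemma mono (hm : IsMean m) {A B : Set Z} (h : A ⊆ B) : m A ≤ m B := by
  have h' := hm.2.2 A (B \ A) Set.disjoint_sdiff_right
  rw [Set.union_sdiff_cancel h] at h'
  linarith [hm.2.1 (B \ A)]

lemma union_le (hm : IsMean m) (A B : Set Z) : m (A ∪ B) ≤ m A + m B := by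
  have h := hm.2.2 A (B \ A) Set.disjoint_sdiff_right
  rw [Set.union_sdiff_self] at h
  linarith [hm.mono (Set.sdiff_subset : B \ A ⊆ B)]

lemma sum_fibers (hm : IsMean m) {κ : Type*} [Fintype κ] (J : Z → κ) (E : Set Z) :
    m E = ∑ k, m (E ∩ J ⁻¹' {k}) := by
  classical
  have key : ∀ s : Finset κ, m (E ∩ J ⁻¹' s) = ∑ k ∈ s, m (E ∩ J ⁻¹' {k}) := by
    intro s
    induction s using Finset.induction_on with
    | empty => simp [hm.empty]
    | insert a s ha ih =>
      rw [Finset.sum_insert ha, ← ih, ← hm.2.2]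
      · rw [← Set.inter_union_distrib_left, ← Set.preimage_union, Finset.coe_insert,
          Set.insert_eq]
      · rw [Set.disjoint_left]
        rintro z ⟨-, hz⟩ ⟨-, hz'⟩
        simp only [Set.mem_preimage, Set.mem_singleton_iff, Finset.mem_coe] at hz hz'
        exact ha (hz ▸ hz')
  simpa using key Finset.univ

end IsMean

section Integral

variable {Z : Type*}

/-- The integral of `φ ∘ J` with respect to a mean, for a map `J` with finite target. -/
noncomputable def fiberSum (m : Set Z → ℝ) {κ : Type*} [Fintype κ] (J : Z → κ) (φ : κ → ℝ) : ℝ :=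
  ∑ k, m (J ⁻¹' {k}) * φ k

lemma fiberSum_comp {m : Set Z → ℝ} (hm : IsMean m) {κ l : Type*} [Fintype κ] [Fintype l]
    (J : Z → κ) (π : κ → l) (φ : l → ℝ) :
    fiberSum m (π ∘ J) φ = fiberSum m J (φ ∘ π) := by
  classical
  unfold fiberSum
  calc ∑ i, m (π ∘ J ⁻¹' {i}) * φ i
      = ∑ i, ∑ k, m (π ∘ J ⁻¹' {i} ∩ J ⁻¹' {k}) * φ i := by
        simp_rw [← Finset.sum_mul, ← hm.sum_fibers J]
    _ = ∑ k, ∑ i, m (π ∘ J ⁻¹' {i} ∩ J ⁻¹' {k}) * φ i := Finset.sum_comm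
    _ = ∑ k, m (J ⁻¹' {k}) * (φ ∘ π) k := by
        refine Finset.sum_congr rfl fun k _ => ?_
        rw [Finset.sum_eq_single (π k)]
        · congr 2
          ext z
          simp only [Set.mem_inter_iff, Set.mem_preimage, Function.comp_apply,
            Set.mem_singleton_iff, and_iff_right_iff_imp]
          intro h
          rw [h]
        · intro i _ hi
          have : π ∘ J ⁻¹' {i} ∩ J ⁻¹' {k} = ∅ := by
            ext z
            simp only [Set.mem_inter_iff, Set.mem_preimage, Function.comp_apply,
              Set.mem_singleton_iff, Set.mem_empty_iff_false, iff_false, not_and]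
            rintro h rfl
            exact hi h.symm
          rw [this, hm.empty, zero_mul]
        · simp

lemma abs_fiberSum_le {m : Set Z → ℝ} (hm : IsMean m) {κ : Type*} [Fintype κ] (J : Z → κ)
    (φ : κ → ℝ) {ε : ℝ} (h : ∀ z, |φ (J z)| ≤ ε) : |fiberSum m J φ| ≤ ε := by
  have h1 : ∑ k, m (J ⁻¹' {k}) = 1 := by
    have := hm.sum_fibers J Set.univ
    simp only [Set.univ_inter] at this
    rw [← this, hm.1]
  calc |fiberSum m J φ| ≤ ∑ k, |m (J ⁻¹' {k}) * φ k| := Finset.abs_sum_le_sum_abs _ _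
    _ ≤ ∑ k, m (J ⁻¹' {k}) * ε := by
        refine Finset.sum_le_sum fun k _ => ?_
        rcases (J ⁻¹' {k}).eq_empty_or_nonempty with h0 | ⟨z, rfl⟩
        · simp [h0, hm.empty]
        · rw [abs_mul, abs_of_nonneg (hm.2.1 _)]
          exact mul_le_mul_of_nonneg_left (h z) (hm.2.1 _)
    _ = ε := by rw [← Finset.sum_mul, h1, one_mul]

lemma abs_fiberSum_add_sub_le {m : Set Z → ℝ} (hm : IsMean m) {κ : Type*} [Fintype κ]
    (J K L : Z → κ) (φ : κ → ℝ) {ε : ℝ} (h : ∀ z, |φ (J z) + φ (K z) - φ (L z)| ≤ ε) :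
    |fiberSum m J φ + fiberSum m K φ - fiberSum m L φ| ≤ ε := by
  let T : Z → κ × κ × κ := fun z => (J z, K z, L z)
  have hJ : fiberSum m J φ = fiberSum m T fun t => φ t.1 := fiberSum_comp hm T Prod.fst φ
  have hK : fiberSum m K φ = fiberSum m T fun t => φ t.2.1 :=
    fiberSum_comp hm T (fun t => t.2.1) φ
  have hL : fiberSum m L φ = fiberSum m T fun t => φ t.2.2 :=
    fiberSum_comp hm T (fun t => t.2.2) φ
  have : fiberSum m J φ + fiberSum m K φ - fiberSum m L φ
      = fiberSum m T fun t => φ t.1 + φ t.2.1 - φ t.2.2 := by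
    rw [hJ, hK, hL]
    simp only [fiberSum, mul_add, mul_sub, Finset.sum_add_distrib, Finset.sum_sub_distrib]
  rw [this]
  exact abs_fiberSum_le hm T _ h

/-- The rounding of `f` down to multiples of `1 / (n + 1)`. -/
noncomputable def roundLevel (n : ℕ) (f : Z → ℝ) (z : Z) : Fin (n + 2) :=
  ⟨min ⌊(n + 1) * f z⌋₊ (n + 1), by omega⟩

lemma abs_roundLevel_sub_le (n : ℕ) {f : Z → ℝ} {z : Z} (h0 : 0 ≤ f z) (h1 : f z ≤ 1) :
    |((roundLevel n f z : ℕ) : ℝ) / (n + 1) - f z| ≤ 1 / (n + 1) := by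
  have hn : (0 : ℝ) < n + 1 := by positivity
  have hle : ⌊(n + 1) * f z⌋₊ ≤ n + 1 := by
    refine Nat.floor_le_of_le ?_
    push_cast
    nlinarith
  have h2 := Nat.floor_le (mul_nonneg hn.le h0)
  have h3 := Nat.lt_floor_add_one ((n + 1) * f z)
  have h4 : ((roundLevel n f z : ℕ) : ℝ) / (n + 1) - f z
      = ((⌊(n + 1) * f z⌋₊ : ℝ) - (n + 1) * f z) / (n + 1) := by
    simp only [roundLevel, min_eq_left hle]
    field_simp
  rw [h4, abs_div, abs_of_pos hn]
  gcongr
  rw [abs_le]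
  constructor <;> linarith

/-- Integration of `[0, 1]`-valued functions with respect to a mean. -/
theorem IsMean.exists_integral {m : Set Z → ℝ} (hm : IsMean m) :
    ∃ I : (Z → ℝ) → ℝ, I (fun _ => 1) = 1 ∧ (∀ f, (∀ z, 0 ≤ f z) → 0 ≤ I f) ∧
      (∀ f g : Z → ℝ, (∀ z, 0 ≤ f z) → (∀ z, 0 ≤ g z) → (∀ z, f z + g z ≤ 1) →
        I (fun z => f z + g z) = I f + I g) ∧
      ∀ e : Z → Z, (∀ A, m (e ⁻¹' A) = m A) → ∀ f, I (fun z => f (e z)) = I f := by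
  let u : (Z → ℝ) → ℕ → ℝ := fun f n =>
    fiberSum m (roundLevel n f) fun k => ((k : ℕ) : ℝ) / (n + 1)
  have hφ0 : ∀ (n : ℕ) (k : Fin (n + 2)), 0 ≤ ((k : ℕ) : ℝ) / (n + 1) := fun n k => by
    positivity
  have hφ1 : ∀ (n : ℕ) (k : Fin (n + 2)), ((k : ℕ) : ℝ) / (n + 1) ≤ 1 := fun n k => by
    rw [div_le_one (by positivity)]
    have : (k : ℕ) ≤ n + 1 := by omega
    exact_mod_cast this
  have hu0 : ∀ f n, 0 ≤ u f n := fun f n =>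
    Finset.sum_nonneg fun k _ => mul_nonneg (hm.2.1 _) (hφ0 n k)
  have hu1 : ∀ f n, u f n ≤ 1 := fun f n =>
    (le_abs_self _).trans <| abs_fiberSum_le hm _ _ fun z => by
      rw [abs_of_nonneg (hφ0 n _)]
      exact hφ1 n _
  have hlim : ∀ f, ∃ a : ℝ, 0 ≤ a ∧
      Filter.Tendsto (u f) (Filter.hyperfilter ℕ : Filter ℕ) (nhds a) := by
    intro f
    obtain ⟨a, ha, hle⟩ := (isCompact_Icc (a := (0 : ℝ)) (b := 1)).ultrafilter_le_nhds
      ((Filter.hyperfilter ℕ).map (u f)) (by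
        rw [Filter.le_principal_iff]
        exact Filter.mem_map.2 (Filter.univ_mem' fun n => ⟨hu0 f n, hu1 f n⟩))
    exact ⟨a, ha.1, hle⟩
  choose I hI0 hI using hlim
  have hsmall : ∀ c : ℝ, Filter.Tendsto (fun n : ℕ => c * (1 / ((n : ℝ) + 1)))
      (Filter.hyperfilter ℕ : Filter ℕ) (nhds 0) := by
    intro c
    have h := (tendsto_one_div_add_atTop_nhds_zero_nat (𝕜 := ℝ)).const_mul c
    rw [mul_zero] at h
    exact h.mono_left Nat.hyperfilter_le_atTop
  refine ⟨I, ?_, fun f _ => hI0 f, ?_, ?_⟩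
  · refine tendsto_nhds_unique (hI _) ?_
    refine tendsto_const_nhds.congr fun n => ?_
    have h1 : ∀ z : Z, roundLevel n (fun _ : Z => (1 : ℝ)) z = Fin.last (n + 1) := by
      intro z
      have : ⌊(n : ℝ) + 1⌋₊ = n + 1 := by exact_mod_cast Nat.floor_natCast (R := ℝ) (n + 1)
      ext
      simp [roundLevel, this]
    have h2 : roundLevel n (fun _ : Z => (1 : ℝ)) = (fun _ : Unit => Fin.last (n + 1)) ∘
        fun _ : Z => () := funext h1
    have hn : (n : ℝ) + 1 ≠ 0 := by positivity
    change 1 = fiberSum m (roundLevel n fun _ : Z => (1 : ℝ)) _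
    rw [h2, fiberSum_comp hm]
    simp [fiberSum, hm.1, hn]
  · intro f g hf hg hfg
    have hd : Filter.Tendsto (fun n => u f n + u g n - u (fun z => f z + g z) n)
        (Filter.hyperfilter ℕ : Filter ℕ) (nhds 0) := by
      refine squeeze_zero_norm (fun n => ?_) (hsmall 3)
      refine abs_fiberSum_add_sub_le hm _ _ _ _ fun z => ?_
      have h1 := abs_roundLevel_sub_le n (hf z) (by linarith [hg z, hfg z])
      have h2 := abs_roundLevel_sub_le n (hg z) (by linarith [hf z, hfg z])
      have h3 := abs_roundLevel_sub_le n (f := fun z => f z + g z) (z := z)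
        (add_nonneg (hf z) (hg z)) (hfg z)
      rw [abs_le] at *
      constructor <;> linarith [h1.1, h1.2, h2.1, h2.2, h3.1, h3.2]
    have := tendsto_nhds_unique hd (((hI f).add (hI g)).sub (hI _))
    linarith
  · intro e he f
    refine tendsto_nhds_unique (hI _) ((hI f).congr fun n => ?_)
    refine Finset.sum_congr rfl fun k _ => ?_
    congr 1
    exact (he (roundLevel n f ⁻¹' {k})).symm

end Integral

section Actions

/-- If `G ⧸ H` has a `G`-invariant mean and `Z` has an `H`-invariant mean, then `Z` has a
`G`-invariant mean. -/
theorem exists_invariant_mean_of_subgroup {G Z : Type*} [Group G] [MulAction G Z]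
    (H : Subgroup G) {m : Set (G ⧸ H) → ℝ} (hm : IsMean m)
    (hinv : ∀ (g : G) (A : Set (G ⧸ H)), m (g • A) = m A)
    {n : Set Z → ℝ} (hn : IsMean n) (hninv : ∀ h ∈ H, ∀ A : Set Z, n (h • A) = n A) :
    ∃ M : Set Z → ℝ, IsMean M ∧ ∀ (g : G) (A : Set Z), M (g • A) = M A := by
  obtain ⟨I, hI1, hI0, hIadd, hIinv⟩ := hm.exists_integral
  let f : Set Z → G ⧸ H → ℝ := fun A y => n (y.out⁻¹ • A)
  have hf : ∀ (A : Set Z) (r : G), f A (r : G ⧸ H) = n (r⁻¹ • A) := by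
    intro A r
    obtain ⟨h, hh⟩ := QuotientGroup.mk_out_eq_mul H r
    simp only [f]
    rw [hh, mul_inv_rev, mul_smul, hninv _ (H.inv_mem h.2)]
  have hadd : ∀ A B : Set Z, Disjoint A B → ∀ y, f (A ∪ B) y = f A y + f B y := by
    intro A B hAB y
    simp only [f]
    rw [Set.smul_set_union, hn.2.2 _ _ (Set.disjoint_smul_set.2 hAB)]
  have huniv : ∀ y, f Set.univ y = 1 := fun y => by
    simp only [f, Set.smul_set_univ, hn.1]
  have hle : ∀ A y, f A y ≤ 1 := fun A y => by
    simp only [f]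
    rw [← hn.1]
    exact hn.mono (Set.subset_univ _)
  refine ⟨fun A => I (f A), ⟨?_, fun A => hI0 _ fun y => hn.2.1 _, fun A B hAB => ?_⟩,
    fun g A => ?_⟩
  · rw [← hI1]
    exact congrArg I (funext huniv)
  · have h := hIadd (f A) (f B) (fun y => hn.2.1 _) (fun y => hn.2.1 _)
      fun y => hadd A B hAB y ▸ hle _ y
    rw [← h]
    exact congrArg I (funext (hadd A B hAB))
  · change I (f (g • A)) = I (f A)
    rw [← hIinv (fun y => g⁻¹ • y) (fun B => by rw [Set.preimage_smul_inv, hinv]) (f A)]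
    refine congrArg I (funext fun y => ?_)
    induction y using QuotientGroup.induction_on with
    | H r =>
      rw [MulAction.Quotient.smul_coe, hf, hf, smul_eq_mul, mul_inv_rev, inv_inv, mul_smul]

/-- An equivariant map exists as soon as stabilizers can be matched. -/
theorem exists_equivariant_map {H Y Z : Type*} [Group H] [MulAction H Y] [MulAction H Z]
    [Nonempty Z] (V : Set Y) (hV : ∀ (h : H), ∀ y ∈ V, h • y ∈ V)
    (hs : ∀ y ∈ V, ∃ z : Z, MulAction.stabilizer H y ≤ MulAction.stabilizer H z) :
    ∃ f : Y → Z, ∀ y ∈ V, ∀ h : H, f (h • y) = h • f y := by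
  classical
  have hs' : ∀ y, ∃ z : Z, y ∈ V → MulAction.stabilizer H y ≤ MulAction.stabilizer H z := by
    intro y
    by_cases hy : y ∈ V
    · obtain ⟨z, hz⟩ := hs y hy
      exact ⟨z, fun _ => hz⟩
    · exact ⟨Classical.arbitrary Z, fun h => absurd h hy⟩
  choose z hz using hs'
  let r : Y → Y := fun y => (Quotient.mk (MulAction.orbitRel H Y) y).out
  have hr : ∀ y, ∃ h : H, h • r y = y := fun y => by
    have : MulAction.orbitRel H Y y (r y) :=
      (MulAction.orbitRel H Y).symm (Quotient.mk_out (s := MulAction.orbitRel H Y) y)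
    exact MulAction.orbitRel_apply.1 this
  have hrs : ∀ (h : H) y, r (h • y) = r y := fun h y => by
    have : Quotient.mk (MulAction.orbitRel H Y) (h • y) = Quotient.mk _ y :=
      Quotient.sound (s := MulAction.orbitRel H Y) ⟨h, rfl⟩
    simp only [r, this]
  choose c hc using hr
  refine ⟨fun y => c y • z (r y), fun y hy h => ?_⟩
  have hry : r y ∈ V := by
    have := hV (c y)⁻¹ y hy
    rwa [inv_smul_eq_iff.2 (hc y).symm] at this
  have hstab : (h * c y)⁻¹ * c (h • y) ∈ MulAction.stabilizer H (r y) := by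
    have := hc (h • y)
    rw [hrs] at this
    rw [MulAction.mem_stabilizer_iff, mul_smul, this, inv_smul_eq_iff, mul_smul, hc]
  have := MulAction.mem_stabilizer_iff.1 (hz _ hry hstab)
  rw [mul_smul, inv_smul_eq_iff] at this
  change c (h • y) • z (r (h • y)) = h • c y • z (r y)
  rw [hrs, this, mul_smul]

end Actions

/-- Either returns to a point have positive measure, or visits to finite sets are negligible. -/
lemma IsMean.return_pos_or_null {Γ X : Type*} [Group Γ] [MulAction Γ X] {m : Set Γ → ℝ} (hm : IsMean m)
    (hinv : ∀ (g : Γ) (A : Set Γ), m ((fun h => g * h) '' A) = m A) (x : X) :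
    0 < m {γ | γ • x = x} ∨ ∀ E : Finset X, m {γ | γ • x ∈ E} = 0 := by
  classical
  rcases (hm.2.1 {γ | γ • x = x}).lt_or_eq with h | h
  · exact Or.inl h
  refine Or.inr fun E => ?_
  have hpt : ∀ p, m {γ | γ • x = p} = 0 := by
    intro p
    by_cases hp : ∃ δ : Γ, δ • x = p
    · obtain ⟨δ, rfl⟩ := hp
      rw [h]
      refine Eq.trans ?_ (hinv δ _)
      congr 1
      ext γ
      simp only [Set.image_mul_left, Set.mem_preimage, Set.mem_ofPred_eq, mul_smul]
      exact inv_smul_eq_iff.symm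
    · have : {γ : Γ | γ • x = p} = ∅ := Set.eq_empty_of_forall_notMem fun γ hγ => hp ⟨γ, hγ⟩
      rw [this, hm.empty]
  induction E using Finset.induction_on with
  | empty => simpa using hm.empty
  | insert p E _ ih =>
    have h1 : {γ : Γ | γ • x ∈ insert p E} = {γ | γ • x = p} ∪ {γ | γ • x ∈ E} := by
      ext γ
      simp
    refine le_antisymm ?_ (hm.2.1 _)
    rw [h1]
    linarith [hm.union_le {γ : Γ | γ • x = p} {γ | γ • x ∈ E}, hpt p]

section FullGroup

open Filter Topology

variable {Γ X : Type*} [Group Γ] [TopologicalSpace X] [MulAction Γ X]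

lemma IsPiecewiseTranslation.exists_local {T : Equiv.Perm X} (hT : IsPiecewiseTranslation Γ T) :
    ∃ (n : ℕ) (J : X → Fin n) (s : Fin n → Γ), ∀ p, ∀ᶠ y in 𝓝 p, T y = s (J p) • y := by
  obtain ⟨n, A, s, hA, -, hU, hs⟩ := hT
  have h : ∀ p, ∃ i, p ∈ A i := fun p => Set.mem_iUnion.1 (hU ▸ Set.mem_univ p)
  choose J hJ using h
  refine ⟨n, J, s, fun p => ?_⟩
  filter_upwards [(hA (J p)).isOpen.mem_nhds (hJ p)] with y hy using hs _ y hy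

lemma IsPiecewiseTranslation.continuous (hcont : ∀ g : Γ, Continuous fun x : X => g • x)
    {T : Equiv.Perm X} (hT : IsPiecewiseTranslation Γ T) : Continuous T := by
  obtain ⟨n, J, s, h⟩ := hT.exists_local
  exact continuous_iff_continuousAt.2 fun p => ((hcont (s (J p))).continuousAt).congr
    ((h p).mono fun _ hy => hy.symm)

lemma mem_nbhdFixing_iff {F : Set X} {g : Equiv.Perm X} :
    g ∈ nbhdFixing X F ↔ ∀ x ∈ F, ∀ᶠ y in 𝓝 x, g y = y := by
  refine forall₂_congr fun x _ => ?_
  rw [eventually_nhds_iff]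
  exact ⟨fun ⟨U, h1, h2, h3⟩ => ⟨U, h3, h1, h2⟩, fun ⟨U, h3, h1, h2⟩ => ⟨U, h1, h2, h3⟩⟩

/-- Three distinct points of an orbit can be cyclically permuted by an element of the dynamical
alternating group that is trivial near a given finite set avoiding them. -/
theorem exists_mem_dynAlternating [CompactSpace X] [T2Space X] [TotallyDisconnectedSpace X]
    (hcont : ∀ g : Γ, Continuous fun x : X => g • x) (F : Finset X) (t : Fin 3 → Γ) (x : X)
    (hinj : Function.Injective fun i => t i • x) (hF : ∀ i, t i • x ∉ F) :
    ∃ g ∈ dynAlternating Γ X, g ∈ nbhdFixing X (F : Set X) ∧ g (t 0 • x) = t 1 • x := by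
  obtain ⟨O, hO, hdisj⟩ := (Set.finite_range fun i => t i • x).t2_separation
  let O' : Set X := ⋂ i, (fun y => t i • y) ⁻¹' (O (t i • x) ∩ (F : Set X)ᶜ)
  have hO'o : IsOpen O' := isOpen_iInter_of_finite fun i =>
    ((hO _).2.inter F.finite_toSet.isClosed.isOpen_compl).preimage (hcont _)
  obtain ⟨U, hU, hxU, hUO⟩ := compact_exists_isClopen_in_isOpen hO'o
    (Set.mem_iInter.2 fun i => ⟨(hO _).1, by simpa using hF i⟩ : x ∈ O')
  have hUO' : ∀ i, ∀ y ∈ U, t i • y ∈ O (t i • x) ∧ t i • y ∉ F := fun i y hy => by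
    simpa using Set.mem_iInter.1 (hUO hy) i
  let ι : Fin 3 × U ↪ X := ⟨fun p => t p.1 • (p.2 : X), by
    rintro ⟨i, y⟩ ⟨j, z⟩ h
    dsimp only at h
    have hij : i = j := by
      by_contra hne
      refine Set.disjoint_left.1 (hdisj ⟨i, rfl⟩ ⟨j, rfl⟩ (hinj.ne hne))
        (hUO' i y y.2).1 ?_
      dsimp only
      rw [h]
      exact (hUO' j z z.2).1
    subst hij
    rw [Subtype.ext (MulAction.injective _ h)]⟩
  have hι : ∀ i y, ι (i, y) = t i • (y : X) := fun _ _ => rfl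
  let φ : Equiv.Perm (Fin 3) →* Equiv.Perm X := (Equiv.Perm.viaEmbeddingHom ι).comp
    { toFun := fun σ => Equiv.prodCongr σ (Equiv.refl U)
      map_one' := rfl
      map_mul' := fun _ _ => rfl }
  have hφ : ∀ σ i (y : U), φ σ (t i • (y : X)) = t (σ i) • (y : X) := fun σ i y =>
    Equiv.Perm.viaEmbedding_apply _ ι (i, y)
  let A : Fin 3 → Set X := fun i => (fun y => (t i)⁻¹ • y) ⁻¹' U
  have hA : ∀ i y, y ∈ A i ↔ ∃ z : U, y = t i • (z : X) := fun i y =>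
    ⟨fun h => ⟨⟨_, h⟩, by simp⟩, by rintro ⟨z, rfl⟩; simp [A]⟩
  have hAc : ∀ i, IsClopen (A i) := fun i => hU.preimage (hcont _)
  have hAd : Pairwise (Function.onFun Disjoint A) := by
    intro i j hij
    rw [Function.onFun, Set.disjoint_left]
    intro y hy hy'
    obtain ⟨z, hz⟩ := (hA i y).1 hy
    obtain ⟨w, hw⟩ := (hA j y).1 hy'
    have := ι.injective ((hι i z).trans (hz.symm.trans (hw.trans (hι j w).symm)))
    exact hij (congrArg Prod.fst this)
  have hφ' : ∀ σ, ∀ y ∉ ⋃ i, A i, φ σ y = y := by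
    intro σ y hy
    refine Equiv.Perm.viaEmbedding_apply_of_notMem _ ι y ?_
    rintro ⟨⟨i, z⟩, rfl⟩
    exact hy (Set.mem_iUnion.2 ⟨i, (hA i _).2 ⟨z, rfl⟩⟩)
  have hAu : IsClopen (⋃ i, A i) := isClopen_iUnion_of_finite hAc
  refine ⟨φ (Equiv.swap 0 1 * Equiv.swap 1 2), ?_, ?_, ?_⟩
  · refine Subgroup.subset_closure ⟨φ, A, fun σ => ?_, hAc, hAd, hφ', fun σ i => ?_, _, ?_, rfl⟩
    · refine ⟨4, Fin.cons (⋃ i, A i)ᶜ A, Fin.cons 1 fun i => t (σ i) * (t i)⁻¹, ?_, ?_, ?_, ?_⟩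
      · intro i
        refine Fin.cases ?_ (fun j => ?_) i
        · exact hAu.compl
        · exact hAc j
      · intro i j
        have h0 : ∀ j, Disjoint (⋃ i, A i)ᶜ (A j) := fun j =>
          Set.disjoint_left.2 fun y hy hy' => hy (Set.mem_iUnion.2 ⟨j, hy'⟩)
        refine Fin.cases (Fin.cases ?_ (fun j => ?_) j) (fun i => Fin.cases ?_ (fun j => ?_) j) i
        · exact fun h => absurd rfl h
        · exact fun _ => h0 j
        · exact fun _ => (h0 i).symm
        · exact fun h => hAd fun h' => h (congrArg Fin.succ h')
      · refine Set.eq_univ_of_forall fun y => ?_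
        by_cases hy : y ∈ ⋃ i, A i
        · obtain ⟨i, hi⟩ := Set.mem_iUnion.1 hy
          exact Set.mem_iUnion.2 ⟨i.succ, hi⟩
        · exact Set.mem_iUnion.2 ⟨0, hy⟩
      · intro i
        refine Fin.cases (fun y hy => ?_) (fun j y hy => ?_) i
        · rw [Fin.cons_zero, one_smul]
          exact hφ' σ y hy
        · obtain ⟨z, rfl⟩ := (hA j y).1 hy
          rw [Fin.cons_succ, mul_smul, inv_smul_smul, hφ]
    · ext y
      constructor
      · rintro ⟨w, hw, rfl⟩
        obtain ⟨z, rfl⟩ := (hA i w).1 hw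
        rw [hφ]
        exact (hA _ _).2 ⟨z, rfl⟩
      · intro hy
        obtain ⟨z, rfl⟩ := (hA _ y).1 hy
        exact ⟨t i • (z : X), (hA _ _).2 ⟨z, rfl⟩, hφ _ _ _⟩
    · decide
  · rw [mem_nbhdFixing_iff]
    intro p hp
    have hp' : p ∉ ⋃ i, A i := fun h => by
      obtain ⟨i, hi⟩ := Set.mem_iUnion.1 h
      obtain ⟨z, rfl⟩ := (hA i p).1 hi
      exact (hUO' i z z.2).2 hp
    filter_upwards [hAu.compl.isOpen.mem_nhds hp'] with y hy using hφ' _ y hy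
  · have := hφ (Equiv.swap 0 1 * Equiv.swap 1 2) 0 ⟨x, hxU⟩
    have h01 : (Equiv.swap (0 : Fin 3) 1 * Equiv.swap 1 2 : Equiv.Perm (Fin 3)) 0 = 1 := by decide
    rwa [h01] at this

/-- Elements of `Γ` carrying `x` into its orbit under the elements of `G` trivial near `F` have
positive measure. -/
lemma IsMean.orbit_pos [CompactSpace X] [T2Space X] [TotallyDisconnectedSpace X]
    (hcont : ∀ g : Γ, Continuous fun x : X => g • x)
    {m : Set Γ → ℝ} (hm : IsMean m)
    (hinv : ∀ (g : Γ) (A : Set Γ), m ((fun h => g * h) '' A) = m A)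
    (F : Finset X) {x : X} (hx : x ∉ F) :
    0 < m {γ | ∃ g ∈ dynAlternating Γ X, g ∈ nbhdFixing X (F : Set X) ∧ g x = γ • x} := by
  classical
  set W : Set Γ := {γ | ∃ g ∈ dynAlternating Γ X, g ∈ nbhdFixing X (F : Set X) ∧ g x = γ • x}
  rcases hm.return_pos_or_null hinv x with h | h
  · refine h.trans_le (hm.mono fun γ hγ => ⟨1, one_mem _, one_mem _, ?_⟩)
    exact (show γ • x = x from hγ).symm
  · have huniv : W ∪ {γ | γ • x ∈ F} = Set.univ := by
      refine Set.eq_univ_of_forall fun γ => ?_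
      by_cases hF : γ • x ∈ F
      · exact Or.inr hF
      refine Or.inl ?_
      by_cases hγ : γ • x = x
      · exact ⟨1, one_mem _, one_mem _, hγ.symm⟩
      obtain ⟨δ, hδ⟩ : ∃ δ : Γ, δ • x ∉ insert x (insert (γ • x) F) := by
        by_contra! hc
        have := h (insert x (insert (γ • x) F))
        rw [Set.eq_univ_of_forall (s := {γ' : Γ | γ' • x ∈ insert x (insert (γ • x) F)}) hc,
          hm.1] at this
        exact one_ne_zero this
      simp only [Finset.mem_insert, not_or] at hδ
      obtain ⟨g, h1, h2, h3⟩ := exists_mem_dynAlternating hcont F ![1, γ, δ] x (by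
        intro i j hij
        have hγ' := Ne.symm hγ
        have hδ1 := Ne.symm hδ.1
        have hδ2 := Ne.symm hδ.2.1
        have := hδ.1
        have := hδ.2.1
        fin_cases i <;> fin_cases j <;> simp_all) (by
        intro i
        fin_cases i
        · simpa using hx
        · exact hF
        · exact hδ.2.2)
      exact ⟨g, h1, h2, by simpa using h3⟩
    have := hm.union_le W {γ | γ • x ∈ F}
    rw [huniv, hm.1, h] at this
    linarith

/-- Adding one point to the finite set: `G_(F)` has an invariant mean on `G / G_(F ∪ {x})`. -/
theorem exists_relative_mean [CompactSpace X] [T2Space X] [TotallyDisconnectedSpace X]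
    (hcont : ∀ g : Γ, Continuous fun x : X => g • x)
    (hamen : HasLeftInvariantMean Γ) (G : Subgroup (Equiv.Perm X))
    (hG : (G : Set (Equiv.Perm X)) ⊆ {T | IsPiecewiseTranslation Γ T})
    (halt : dynAlternating Γ X ≤ G) (F : Finset X) {x : X} (hx : x ∉ F) :
    ∃ n : Set (G ⧸ (nbhdFixing X (insert x (F : Set X))).subgroupOf G) → ℝ, IsMean n ∧
      ∀ h ∈ (nbhdFixing X (F : Set X)).subgroupOf G, ∀ A, n (h • A) = n A := by
  have hcancel : ∀ (T : Equiv.Perm X) y, T⁻¹ (T y) = y := fun T => T.symm_apply_apply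
  have hcancel' : ∀ (T : Equiv.Perm X) y, T (T⁻¹ y) = y := fun T => T.apply_symm_apply
  obtain ⟨m, hm, hinv⟩ := hamen
  set H := (nbhdFixing X (F : Set X)).subgroupOf G with hH
  let q : Γ → Germ (𝓝 x) X := fun γ => ((fun y => γ • y : X → X) : Germ (𝓝 x) X)
  let W : Set Γ := {γ | ∃ h : H, ((h : G) : Equiv.Perm X) x = γ • x}
  have hWpos : 0 < m W :=
    (hm.orbit_pos hcont hinv F hx).trans_le <| hm.mono fun γ ⟨g, h1, h2, h3⟩ =>
      ⟨⟨⟨g, halt h1⟩, h2⟩, h3⟩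
  have hq : ∀ (h : H) (s γ : Γ), (∀ᶠ y in 𝓝 (γ • x), ((h : G) : Equiv.Perm X) y = s • y) →
      h • q γ = q (s * γ) := by
    intro h s γ hs
    refine Germ.coe_eq.2 ?_
    filter_upwards [(hcont γ).continuousAt.eventually hs] with y hy
    rw [mul_smul]
    exact hy
  have hWmem : ∀ (h : H) (s γ : Γ), ((h : G) : Equiv.Perm X) (γ • x) = s • γ • x →
      (s * γ ∈ W ↔ γ ∈ W) := by
    intro h s γ hs
    constructor
    · rintro ⟨k, hk⟩
      refine ⟨h⁻¹ * k, ?_⟩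
      change ((h : G) : Equiv.Perm X)⁻¹ (((k : G) : Equiv.Perm X) x) = γ • x
      rw [hk, mul_smul, ← hs, hcancel]
    · rintro ⟨k, hk⟩
      refine ⟨h * k, ?_⟩
      change ((h : G) : Equiv.Perm X) (((k : G) : Equiv.Perm X) x) = (s * γ) • x
      rw [hk, mul_smul, hs]
  obtain ⟨f, hf⟩ := exists_equivariant_map (H := H)
    (Z := G ⧸ (nbhdFixing X (insert x (F : Set X))).subgroupOf G) (q '' W) (by
      rintro h _ ⟨γ, hγ, rfl⟩
      obtain ⟨n, J, s, hs⟩ := (hG (h : G).2).exists_local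
      exact ⟨s (J (γ • x)) * γ, (hWmem h _ γ (hs _).self_of_nhds).2 hγ,
        (hq h _ γ (hs _)).symm⟩) (by
      rintro _ ⟨γ, ⟨k, hk⟩, rfl⟩
      refine ⟨((k : G) : G ⧸ _), fun h hh => ?_⟩
      have hh' : ∀ᶠ y in 𝓝 x, ((h : G) : Equiv.Perm X) (γ • y) = γ • y := Germ.coe_eq.1 hh
      have hloc : ∀ᶠ w in 𝓝 (γ • x), ((h : G) : Equiv.Perm X) w = w := by
        have ht : Tendsto (fun w : X => γ⁻¹ • w) (𝓝 (γ • x)) (𝓝 x) := by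
          simpa using (hcont γ⁻¹).tendsto (γ • x)
        filter_upwards [ht.eventually hh'] with w hw
        simpa using hw
      refine Eq.symm (QuotientGroup.eq (b := (h : G) * (k : G)).2 ?_)
      refine mem_nbhdFixing_iff.2 ?_
      rintro y (rfl | hy)
      · have hkc : Tendsto ((k : G) : Equiv.Perm X) (𝓝 y) (𝓝 (γ • y)) := by
          rw [← hk]
          exact ((hG (k : G).2).continuous hcont).tendsto y
        filter_upwards [hkc.eventually hloc] with z hz
        change ((k : G) : Equiv.Perm X)⁻¹
          (((h : G) : Equiv.Perm X) (((k : G) : Equiv.Perm X) z)) = z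
        rw [hz, hcancel]
      · exact mem_nbhdFixing_iff.1 (k⁻¹ * (h * k)).2 y hy)
  let E : Set (G ⧸ (nbhdFixing X (insert x (F : Set X))).subgroupOf G) → Set Γ :=
    fun A => {γ | γ ∈ W ∧ f (q γ) ∈ A}
  refine ⟨fun A => m (E A) / m W, ⟨?_, fun A => div_nonneg (hm.2.1 _) (hm.2.1 _), ?_⟩, ?_⟩
  · have : E Set.univ = W := by
      ext γ
      simp [E]
    dsimp only
    rw [this, div_self hWpos.ne']
  · intro A B hAB
    have h1 : E (A ∪ B) = E A ∪ E B := by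
      ext γ
      simp only [E, Set.mem_union, Set.mem_ofPred_eq, and_or_left]
    have h2 : Disjoint (E A) (E B) := Set.disjoint_left.2 fun γ h h' =>
      Set.disjoint_left.1 hAB h.2 h'.2
    dsimp only
    rw [h1, hm.2.2 _ _ h2, add_div]
  · intro g hg A
    let h : H := ⟨g, hg⟩
    obtain ⟨n, J, s, hs⟩ := (hG g.2).exists_local
    have hs' : ∀ p, (g : Equiv.Perm X) p = s (J p) • p := fun p => (hs p).self_of_nhds
    have hE : ∀ γ : Γ, s (J (γ • x)) * γ ∈ E (g • A) ↔ γ ∈ E A := by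
      intro γ
      refine and_congr_right_iff.2 ?_ |>.trans (and_congr_left' (hWmem h _ γ (hs' _)))
      intro hγ
      have hγW : γ ∈ W := (hWmem h _ γ (hs' _)).1 hγ
      rw [← hq h _ γ (hs _), hf _ ⟨γ, hγW, rfl⟩]
      exact Set.smul_mem_smul_set_iff
    dsimp only
    congr 1
    rw [hm.sum_fibers (fun γ => J (γ • x)) (E A),
      hm.sum_fibers (fun γ => J ((g : Equiv.Perm X)⁻¹ (γ • x))) (E (g • A))]
    refine Finset.sum_congr rfl fun k _ => ?_
    refine Eq.trans ?_ (hinv (s k) _)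
    congr 1
    ext γ
    constructor
    · rintro ⟨h1, h2⟩
      have h2' : J ((g : Equiv.Perm X)⁻¹ (γ • x)) = k := h2
      have h3 : (g : Equiv.Perm X)⁻¹ (γ • x) = ((s k)⁻¹ * γ) • x := by
        have := hs' ((g : Equiv.Perm X)⁻¹ (γ • x))
        rw [hcancel', h2'] at this
        rw [mul_smul, this, inv_smul_smul, ← this]
      rw [h3] at h2'
      refine ⟨(s k)⁻¹ * γ, ⟨(hE _).1 ?_, h2'⟩, by simp⟩
      rwa [h2', mul_inv_cancel_left]
    · rintro ⟨δ, ⟨h1, h2⟩, rfl⟩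
      have h2' : J (δ • x) = k := h2
      refine ⟨?_, ?_⟩
      · have := (hE δ).2 h1
        rwa [h2'] at this
      · change J ((g : Equiv.Perm X)⁻¹ ((s k * δ) • x)) = k
        rw [mul_smul, ← h2', ← hs', hcancel]

end FullGroup

/-- For an action of a countable amenable group `Γ` on the Cantor set `X`, a subgroup `G` of
the topological full group containing `𝔄(Γ, X)`, and a finite set `F ⊆ X`, the translation
action of `G` on `G/G_(F)` admits a `G`-invariant mean. -/
theorem stmt13 {Γ X : Type*} [Group Γ] [Countable Γ] [TopologicalSpace X] [CompactSpace X]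
    [TopologicalSpace.MetrizableSpace X] [TotallyDisconnectedSpace X] [Nonempty X]
    [MulAction Γ X]
    (hiso : ∀ x : X, ¬ IsOpen ({x} : Set X))
    (hcont : ∀ g : Γ, Continuous fun x : X => g • x)
    (hamen : HasLeftInvariantMean Γ)
    (G : Subgroup (Equiv.Perm X))
    (hG : (G : Set (Equiv.Perm X)) ⊆ {T | IsPiecewiseTranslation Γ T})
    (halt : dynAlternating Γ X ≤ G)
    (F : Finset X) :
    ∃ m : Set (G ⧸ (nbhdFixing X (↑F : Set X)).subgroupOf G) → ℝ, IsMean m ∧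
      ∀ (g : G) (A : Set (G ⧸ (nbhdFixing X (↑F : Set X)).subgroupOf G)),
        m (g • A) = m A := by
  classical
  induction F using Finset.induction_on with
  | empty =>
    have htop : (nbhdFixing X ((∅ : Finset X) : Set X)).subgroupOf G = ⊤ := by
      rw [eq_top_iff]
      intro g _ x hx
      simp at hx
    have : Subsingleton (G ⧸ (nbhdFixing X ((∅ : Finset X) : Set X)).subgroupOf G) := by
      rw [htop]
      exact QuotientGroup.subsingleton_quotient_top
    let o : G ⧸ (nbhdFixing X ((∅ : Finset X) : Set X)).subgroupOf G := ((1 : G) : G ⧸ _)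
    refine ⟨fun A => A.indicator 1 o, ⟨by simp, fun A => ?_, fun A B hAB => ?_⟩, fun g A => ?_⟩
    · exact Set.indicator_nonneg (fun _ _ => zero_le_one) o
    · exact congrFun (Set.indicator_union_of_disjoint hAB 1) o
    · have : g • A = A := by
        refine (Set.image_congr fun y _ => Subsingleton.elim (g • y) y).trans ?_
        exact Set.image_id A
      rw [this]
  | insert x F hx ih =>
    obtain ⟨m, hm, hinv⟩ := ih
    obtain ⟨n, hn, hninv⟩ := exists_relative_mean hcont hamen G hG halt F hx
    rw [Finset.coe_insert]
    exact exists_invariant_mean_of_subgroup _ hm hinv hn hninv
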